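/- Let g be a finite-dimensional complex semisimple Lie algebra and (h, e, f) an sl2-triple in g, and let g_0, g_2, g_{−2} denote the eigenspaces of ad h with eigenvalues 0, 2, −2 respectively. Then [g_0, f] = g_{−2} and [g_0, e] = g_2; that is, every element of g_{−2} is of the form [x, f] for some x ∈ g_0, and every element of g_2 is of the form [x, e] for some x ∈ g_0. (This is the infinitesimal form of the Kostant–Malcev theorem that f and e lie in the unique open dense L-orbits in g_{−2} and g_2.) -/

import Mathlib

namespace IsSl2Triple

open LieModule Module

variable {K L M : Type*} [Field K] [LieRing L] [LieAlgebra K L]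
  [AddCommGroup M] [Module K M] [LieRingModule L M] [LieModule K L M] {h e f : L}

lemma lie_f_pow_succ_toEnd_e (t : IsSl2Triple h e f) {m : M} (hm : ⁅h, m⁆ = (2 : K) • m)
    (hfm : ⁅e, ⁅f, m⁆⁆ = 0) (n : ℕ) :
    ⁅f, (toEnd K L M e ^ (n + 1)) m⁆ =
      (-((n + 1) * (n + 2)) : K) • (toEnd K L M e ^ n) m := by
  have hcomm (x : M) : ⁅f, ⁅e, x⁆⁆ = ⁅e, ⁅f, x⁆⁆ - ⁅h, x⁆ := by
    rw [leibniz_lie e, t.lie_e_f]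
    abel
  induction n with
  | zero => simp [hcomm, hm, hfm]
  | succ n ih =>
    rw [← lie_e_pow_toEnd_e, hcomm, ih, t.lie_h_pow_toEnd_e hm, lie_smul, lie_e_pow_toEnd_e,
      ← sub_smul]
    push_cast
    congr 1
    ring

variable [CharZero K] [FiniteDimensional K M]

variable (K) in
lemma exists_pow_toEnd_e_eq_zero (t : IsSl2Triple h e f) {m : M} {μ : K}
    (hm : ⁅h, m⁆ = μ • m) : ∃ n : ℕ, (toEnd K L M e ^ n) m = 0 := by
  by_contra! hne
  have hinj : Function.Injective fun n : ℕ ↦ μ + 2 * (n : K) := fun a b hab ↦ by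
    simpa using hab
  have hli := (toEnd K L M h).eigenvectors_linearIndependent' _ hinj
    (fun n ↦ (toEnd K L M e ^ n) m)
    fun n ↦ ⟨by simpa using t.lie_h_pow_toEnd_e hm n, hne n⟩
  exact not_finite_iff_infinite.mpr inferInstance hli.finite

lemma eq_zero_of_lie_e_lie_f_eq_zero (t : IsSl2Triple h e f) {m : M}
    (hm : ⁅h, m⁆ = (2 : K) • m) (hfm : ⁅e, ⁅f, m⁆⁆ = 0) : m = 0 := by
  by_contra hne
  obtain ⟨n, hn, hn'⟩ := Nat.exists_not_and_succ_of_not_zero_of_exists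
    (p := fun n ↦ (toEnd K L M e ^ n) m = 0) (by simpa using hne)
    (t.exists_pow_toEnd_e_eq_zero K hm)
  have key := t.lie_f_pow_succ_toEnd_e hm hfm n
  rw [hn', lie_zero, eq_comm, smul_eq_zero_iff_left hn, neg_eq_zero] at key
  exact mul_ne_zero (Nat.cast_add_one_ne_zero n) (by exact_mod_cast (n + 1).succ_ne_zero) key

/-- In a finite-dimensional representation, `e` maps the weight space `0` onto the weight
space `2`. -/
lemma exists_lie_e_eq (t : IsSl2Triple h e f) {m : M} (hm : ⁅h, m⁆ = (2 : K) • m) :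
    ∃ x : M, ⁅h, x⁆ = 0 ∧ ⁅e, x⁆ = m := by
  have hf (x : M) (hx : ⁅h, x⁆ = (2 : K) • x) : ⁅h, ⁅f, x⁆⁆ = 0 := by
    rw [leibniz_lie, t.lie_lie_smul_f K, hx, neg_lie, smul_lie, lie_smul, neg_add_cancel]
  have he (x : M) (hx : ⁅h, x⁆ = 0) : ⁅h, ⁅e, x⁆⁆ = (2 : K) • ⁅e, x⁆ := by
    rw [leibniz_lie, t.lie_h_e_smul K, hx, smul_lie, lie_zero, add_zero]
  let V := End.eigenspace (toEnd K L M h) (2 : K)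
  let φ : V →ₗ[K] V := (toEnd K L M e ∘ₗ toEnd K L M f).restrict fun x hx ↦ by
    rw [End.mem_eigenspace_iff] at hx ⊢
    exact he _ (hf x hx)
  have hφ : Function.Injective φ := (injective_iff_map_eq_zero φ).mpr fun x hx ↦
    Subtype.ext (t.eq_zero_of_lie_e_lie_f_eq_zero (End.mem_eigenspace_iff.mp x.2)
      (congrArg Subtype.val hx))
  obtain ⟨x, hx⟩ := LinearMap.injective_iff_surjective.mp hφ ⟨m, End.mem_eigenspace_iff.mpr hm⟩
  exact ⟨⁅f, (x : M)⁆, hf x (End.mem_eigenspace_iff.mp x.2), congrArg Subtype.val hx⟩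

end IsSl2Triple


/-- infinitesimal Kostant–Malcev.  Let `(h, e, f)` be an sl2-triple in a
finite-dimensional complex semisimple Lie algebra, and `g_0, g_2, g_{−2}` the eigenspaces
of `ad h` with eigenvalues `0, 2, −2`.  Then `[g_0, f] = g_{−2}` and `[g_0, e] = g_2`. -/
theorem bracket_g0_f_eq_gm2_and_bracket_g0_e_eq_g2
    {L : Type*} [LieRing L] [LieAlgebra ℂ L] [FiniteDimensional ℂ L]
    [LieAlgebra.IsSemisimple ℂ L]
    (h e f : L) (he : e ≠ 0)
    (hhe : ⁅h, e⁆ = (2 : ℂ) • e) (hhf : ⁅h, f⁆ = (-2 : ℂ) • f) (hef : ⁅e, f⁆ = h) :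
    (∀ x ∈ Module.End.eigenspace (LieAlgebra.ad ℂ L h) (0 : ℂ),
      ⁅x, f⁆ ∈ Module.End.eigenspace (LieAlgebra.ad ℂ L h) (-2 : ℂ)) ∧
    (∀ y ∈ Module.End.eigenspace (LieAlgebra.ad ℂ L h) (-2 : ℂ),
      ∃ x ∈ Module.End.eigenspace (LieAlgebra.ad ℂ L h) (0 : ℂ), y = ⁅x, f⁆) ∧
    (∀ x ∈ Module.End.eigenspace (LieAlgebra.ad ℂ L h) (0 : ℂ),
      ⁅x, e⁆ ∈ Module.End.eigenspace (LieAlgebra.ad ℂ L h) (2 : ℂ)) ∧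
    (∀ y ∈ Module.End.eigenspace (LieAlgebra.ad ℂ L h) (2 : ℂ),
      ∃ x ∈ Module.End.eigenspace (LieAlgebra.ad ℂ L h) (0 : ℂ), y = ⁅x, e⁆) := by
  have t : IsSl2Triple h e f :=
    { h_ne_zero := by
        rintro rfl
        exact smul_ne_zero (two_ne_zero (α := ℂ)) he (by rw [← hhe, zero_lie])
      lie_e_f := hef
      lie_h_e_nsmul := by rw [hhe, ofNat_smul_eq_nsmul]
      lie_h_f_nsmul := by rw [hhf, neg_smul, ofNat_smul_eq_nsmul] }
  simp only [Module.End.mem_eigenspace_iff, LieAlgebra.ad_apply, zero_smul]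
  refine ⟨fun x hx ↦ ?_, fun y hy ↦ ?_, fun x hx ↦ ?_, fun y hy ↦ ?_⟩
  · rw [leibniz_lie, hx, hhf, zero_lie, zero_add, lie_smul]
  · obtain ⟨x, hx, rfl⟩ := t.symm.exists_lie_e_eq (K := ℂ) (m := y) (by simp [hy])
    rw [neg_lie, neg_eq_zero] at hx
    exact ⟨-x, by rw [lie_neg, hx, neg_zero], by simp⟩
  · rw [leibniz_lie, hx, hhe, zero_lie, zero_add, lie_smul]
  · obtain ⟨x, hx, rfl⟩ := t.exists_lie_e_eq hy
    exact ⟨-x, by rw [lie_neg, hx, neg_zero], by simp⟩
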